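/- arXiv:1206.3763 — 4 statements merged into one kernel-verified Lean document; each statement's English description precedes it below -/
import Mathlib

section
/- Let n≥2, let A be an n×n real symmetric (or Hermitian) matrix, fix 1≤j≤n, and let B be the (n−1)×(n−1) matrix obtained from A by deleting the j-th row and the j-th column. Then for every complex z with Im z>0, |Tr((A−zI_n)^{−1})−Tr((B−zI_{n−1})^{−1})| ≤ (π+1)/Im(z). -/
open Matrix Complex

lemma aux_im {m : ℕ} (A : Matrix (Fin m) (Fin m) ℝ) (hA : A.IsSymm) (z : ℂ) (v : Fin m → ℂ) :
    (∑ i, star (v i) * ((A.map (fun x : ℝ => (x : ℂ)) - z • (1 : Matrix (Fin m) (Fin m) ℂ)) *ᵥ v) i).im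
      = - (z.im * ∑ i, Complex.normSq (v i)) := by
  have h1 : ∀ i, ((A.map (fun x : ℝ => (x : ℂ)) - z • (1 : Matrix (Fin m) (Fin m) ℂ)) *ᵥ v) i
      = (∑ k, (A i k : ℂ) * v k) - z * v i := by
    intro i
    rw [Matrix.sub_mulVec, Matrix.smul_mulVec, Matrix.one_mulVec]
    simp [Matrix.mulVec, dotProduct]
  have h2 : (∑ i, star (v i) * ∑ k, (A i k : ℂ) * v k).im = 0 := by
    rw [← Complex.conj_eq_iff_im]
    simp only [map_sum, map_mul, Finset.mul_sum, Complex.conj_ofReal]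
    rw [Finset.sum_comm]
    refine Finset.sum_congr rfl fun i _ => Finset.sum_congr rfl fun k _ => ?_
    rw [hA.apply i k]
    simp
    ring
  have h3 : ∀ i, star (v i) * (z * v i) = z * (Complex.normSq (v i) : ℂ) := by
    intro i
    rw [Complex.normSq_eq_conj_mul_self]
    simp
    ring
  simp only [h1, mul_sub, Finset.sum_sub_distrib, Complex.sub_im, h2, h3]
  rw [← Finset.mul_sum, ← Complex.ofReal_sum, Complex.im_mul_ofReal]
  ring

theorem trace_resolvent_submatrix_bound
    (n : ℕ) (hn : 1 ≤ n)
    (A : Matrix (Fin (n + 1)) (Fin (n + 1)) ℝ) (hA : A.IsSymm)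
    (j : Fin (n + 1))
    (B : Matrix (Fin n) (Fin n) ℝ)
    (hB : B = A.submatrix j.succAbove j.succAbove)
    (z : ℂ) (hz : 0 < z.im) :
    ‖((A.map (fun x : ℝ => (x : ℂ)) - z • (1 : Matrix (Fin (n + 1)) (Fin (n + 1)) ℂ))⁻¹).trace
        - ((B.map (fun x : ℝ => (x : ℂ)) - z • (1 : Matrix (Fin n) (Fin n) ℂ))⁻¹).trace‖
      ≤ (Real.pi + 1) / z.im := by
  have key := aux_im A hA z
  have hC : B.map (fun x : ℝ => (x : ℂ)) - z • (1 : Matrix (Fin n) (Fin n) ℂ)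
      = (A.map (fun x : ℝ => (x : ℂ)) - z • (1 : Matrix (Fin (n + 1)) (Fin (n + 1)) ℂ)).submatrix
        j.succAbove j.succAbove := by
    subst hB
    ext i k
    simp [Matrix.one_apply]
  have hMs : (A.map (fun x : ℝ => (x : ℂ)) - z • (1 : Matrix (Fin (n + 1)) (Fin (n + 1)) ℂ)).IsSymm := by
    ext i k
    simp [Matrix.one_apply, hA.apply i k, eq_comm]
  rw [hC]
  generalize A.map (fun x : ℝ => (x : ℂ)) - z • (1 : Matrix (Fin (n + 1)) (Fin (n + 1)) ℂ) = M at *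
  have hdet : M.det ≠ 0 := by
    intro h0
    obtain ⟨v, hv, hMv⟩ := Matrix.exists_mulVec_eq_zero_iff.mpr h0
    have h := key v
    rw [hMv] at h
    simp only [Pi.zero_apply, mul_zero, Finset.sum_const_zero, Complex.zero_im] at h
    have h' : ∑ i, Complex.normSq (v i) = 0 := by
      have : z.im * ∑ i, Complex.normSq (v i) = 0 := by linarith
      exact (mul_eq_zero.mp this).resolve_left hz.ne'
    rw [Finset.sum_eq_zero_iff_of_nonneg (fun i _ => Complex.normSq_nonneg _)] at h'
    exact hv (funext fun i => Complex.normSq_eq_zero.mp (h' i (Finset.mem_univ i)))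
  have hMG : M * M⁻¹ = 1 := Matrix.mul_nonsing_inv M (isUnit_iff_ne_zero.mpr hdet)
  have hGs : ∀ i k, M⁻¹ i k = M⁻¹ k i := by
    intro i k
    have : (M⁻¹)ᵀ = M⁻¹ := by rw [Matrix.transpose_nonsing_inv, hMs.eq]
    conv_lhs => rw [← this]
    rfl
  generalize M⁻¹ = G at *
  have hent : ∀ i k, ∑ l, M i l * G l k = if i = k then 1 else 0 := by
    intro i k
    rw [← Matrix.mul_apply, hMG, Matrix.one_apply]
  set S := ∑ i, Complex.normSq (G i j) with hS
  have him : (G j j).im = z.im * S := by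
    have h := key (fun i => G i j)
    have h4 : M *ᵥ (fun i => G i j) = fun i => if i = j then 1 else 0 := by
      ext i
      exact hent i j
    rw [h4] at h
    simp at h
    linarith
  have hSpos : 0 < S := by
    refine lt_of_le_of_ne (Finset.sum_nonneg fun i _ => Complex.normSq_nonneg _) fun h0 => ?_
    have h' := h0.symm
    rw [hS, Finset.sum_eq_zero_iff_of_nonneg (fun i _ => Complex.normSq_nonneg _)] at h'
    have h5 := hent j j
    rw [Finset.sum_eq_zero] at h5
    · simp at h5
    · intro l hl
      rw [Complex.normSq_eq_zero.mp (h' l hl), mul_zero]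
  have hne : G j j ≠ 0 := by
    intro h0
    rw [h0, Complex.zero_im] at him
    exact (mul_pos hz hSpos).ne him
  let K : Matrix (Fin n) (Fin n) ℂ := fun i k =>
    G (j.succAbove i) (j.succAbove k) - G (j.succAbove i) j * G (j.succAbove k) j / G j j
  have hK : (M.submatrix j.succAbove j.succAbove)⁻¹ = K := by
    apply Matrix.inv_eq_right_inv
    ext i k
    have h6 : ∑ l, M (j.succAbove i) l * (G l (j.succAbove k) - G l j * G (j.succAbove k) j / G j j)
        = if i = k then 1 else 0 := by
      have : ∀ l, M (j.succAbove i) l * (G l (j.succAbove k) - G l j * G (j.succAbove k) j / G j j)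
          = M (j.succAbove i) l * G l (j.succAbove k)
            - (M (j.succAbove i) l * G l j) * (G (j.succAbove k) j / G j j) := by
        intro l; ring
      simp only [this, Finset.sum_sub_distrib]
      rw [← Finset.sum_mul, hent, hent]
      simp
    rw [Fin.sum_univ_succAbove _ j, hGs j (j.succAbove k), mul_div_cancel_left₀ _ hne, sub_self,
      mul_zero, zero_add] at h6
    rw [Matrix.mul_apply, Matrix.one_apply, ← h6]
    rfl
  have htr : G.trace - K.trace = (∑ i, G i j * G i j) / G j j := by
    simp only [Matrix.trace, Matrix.diag, K]
    rw [Finset.sum_sub_distrib, Fin.sum_univ_succAbove _ j, Fin.sum_univ_succAbove _ j,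
      ← Finset.sum_div]
    field_simp
    ring
  rw [hK, htr, norm_div]
  have hnum : ‖∑ i, G i j * G i j‖ ≤ S := by
    refine (norm_sum_le _ _).trans (le_of_eq (Finset.sum_congr rfl fun i _ => ?_))
    rw [norm_mul, Complex.normSq_eq_norm_sq, sq]
  have hden : z.im * S ≤ ‖G j j‖ := by
    rw [← him]
    exact (le_abs_self _).trans (Complex.abs_im_le_norm _)
  have hpi := Real.pi_pos
  rw [div_le_div_iff₀ (norm_pos_iff.mpr hne) hz]
  have h7 : ‖∑ i, G i j * G i j‖ * z.im ≤ ‖G j j‖ := by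
    nlinarith
  nlinarith [norm_nonneg (G j j), mul_nonneg hpi.le (norm_nonneg (G j j))]
end

section
/- Let A and B be n×n real symmetric matrices and let z be a complex number with Im z>0. Then |m_A(z)−m_B(z)|² ≤ (1/(n·(Im z)^4))·Σ_{i,j=1}^n |A_{ij}−B_{ij}|². -/
open Matrix MeasureTheory

/-- Stieltjes transform of an `n × n` real matrix:
`m_M(z) = n⁻¹ · Tr((M − z·I)⁻¹)`. -/
noncomputable def stieltjesTransform {n : ℕ} (M : Matrix (Fin n) (Fin n) ℝ) (z : ℂ) : ℂ :=
  (n : ℂ)⁻¹ * ((M.map (fun x : ℝ => (x : ℂ)) - z • (1 : Matrix (Fin n) (Fin n) ℂ))⁻¹).trace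

theorem aux_spec {n : ℕ} (A : Matrix (Fin n) (Fin n) ℝ) (hA : A.IsSymm) :
    ∃ (U : Matrix (Fin n) (Fin n) ℝ) (d : Fin n → ℝ), Uᵀ * U = 1 ∧ U * Uᵀ = 1 ∧
      A = U * diagonal d * Uᵀ := by
  have hH : A.IsHermitian := by
    rw [Matrix.IsHermitian, Matrix.conjTranspose_eq_transpose_of_trivial]; exact hA
  have h := hH.spectral_theorem
  have h1 := Unitary.star_mul_self_of_mem hH.eigenvectorUnitary.2
  have h2 := Unitary.mul_star_self_of_mem hH.eigenvectorUnitary.2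
  rw [Matrix.star_eq_conjTranspose, Matrix.conjTranspose_eq_transpose_of_trivial] at h1 h2
  refine ⟨hH.eigenvectorUnitary, hH.eigenvalues, h1, h2, ?_⟩
  rw [Unitary.conjStarAlgAut_apply, Matrix.star_eq_conjTranspose,
    Matrix.conjTranspose_eq_transpose_of_trivial] at h
  exact h

theorem aux_ne (x : ℝ) (z : ℂ) (hz : 0 < z.im) : (x : ℂ) - z ≠ 0 := by
  intro h
  have := congrArg Complex.im h
  simp at this
  exact hz.ne' this

theorem aux_trace {n : ℕ} (U : Matrix (Fin n) (Fin n) ℝ) (d : Fin n → ℝ)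
    (h1 : Uᵀ * U = 1) (h2 : U * Uᵀ = 1) (z : ℂ) (hz : 0 < z.im) :
    stieltjesTransform (U * diagonal d * Uᵀ) z = (n : ℂ)⁻¹ * ∑ i, ((d i : ℂ) - z)⁻¹ := by
  unfold stieltjesTransform
  congr 1
  set V : Matrix (Fin n) (Fin n) ℂ := U.map Complex.ofRealHom with hV
  have g1 : Vᵀ * V = 1 := by
    rw [hV, ← Matrix.transpose_map, ← Matrix.map_mul, h1]; simp
  have g2 : V * Vᵀ = 1 := by
    rw [hV, ← Matrix.transpose_map, ← Matrix.map_mul, h2]; simp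
  have e0 : (U * diagonal d * Uᵀ).map (fun x : ℝ => (x : ℂ))
      = V * diagonal (fun i => (d i : ℂ)) * Vᵀ := by
    have : (U * diagonal d * Uᵀ).map (fun x : ℝ => (x : ℂ))
      = (U * diagonal d * Uᵀ).map Complex.ofRealHom := rfl
    rw [this, Matrix.map_mul, Matrix.map_mul, Matrix.diagonal_map (by simp)]
    rfl
  have e1 : (U * diagonal d * Uᵀ).map (fun x : ℝ => (x : ℂ)) - z • (1 : Matrix (Fin n) (Fin n) ℂ)
      = V * diagonal (fun i => (d i : ℂ) - z) * Vᵀ := by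
    have : diagonal (fun i => (d i : ℂ) - z) = diagonal (fun i => (d i : ℂ))
        - z • (1 : Matrix (Fin n) (Fin n) ℂ) := by
      ext i j
      by_cases h : i = j
      · subst h; simp
      · simp [h]
    rw [e0, this, mul_sub, sub_mul, mul_smul_comm, smul_mul_assoc, mul_one, g2]
  have e2 : (V * diagonal (fun i => (d i : ℂ) - z) * Vᵀ)⁻¹
      = V * diagonal (fun i => ((d i : ℂ) - z)⁻¹) * Vᵀ := by
    apply Matrix.inv_eq_right_inv
    calc _ = V * diagonal (fun i => (d i : ℂ) - z) * (Vᵀ * V)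
          * diagonal (fun i => ((d i : ℂ) - z)⁻¹) * Vᵀ := by simp only [mul_assoc]
      _ = V * (diagonal (fun i => (d i : ℂ) - z) * diagonal (fun i => ((d i : ℂ) - z)⁻¹)) * Vᵀ := by
        rw [g1, mul_one]; simp only [mul_assoc]
      _ = 1 := by
        rw [Matrix.diagonal_mul_diagonal]
        simp only [mul_inv_cancel₀ (aux_ne _ z hz), Matrix.diagonal_one, mul_one, g2]
  rw [e1, e2, Matrix.trace_mul_comm, ← mul_assoc, g1, one_mul, Matrix.trace_diagonal]

theorem aux_frob {n : ℕ} (M : Matrix (Fin n) (Fin n) ℝ) :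
    ∑ i, ∑ j, M i j ^ 2 = (M * Mᵀ).trace := by
  simp [Matrix.trace, Matrix.mul_apply, sq]

theorem aux_lip (x y : ℝ) (z : ℂ) (hz : 0 < z.im) :
    ‖((x : ℂ) - z)⁻¹ - ((y : ℂ) - z)⁻¹‖ ^ 2 ≤ (x - y) ^ 2 / z.im ^ 4 := by
  have b : ∀ t : ℝ, z.im ≤ ‖(t : ℂ) - z‖ := fun t => by
    have := Complex.abs_im_le_norm ((t : ℂ) - z)
    simpa [abs_of_pos hz] using this
  have e : ((x : ℂ) - z)⁻¹ - ((y : ℂ) - z)⁻¹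
      = ((y - x : ℝ) : ℂ) / (((x : ℂ) - z) * ((y : ℂ) - z)) := by
    have := aux_ne x z hz
    have := aux_ne y z hz
    push_cast
    field_simp
    ring
  rw [e, norm_div, norm_mul, Complex.norm_real, div_pow, Real.norm_eq_abs, sq_abs,
    show (y - x) ^ 2 = (x - y) ^ 2 by ring, show z.im ^ 4 = (z.im * z.im) ^ 2 by ring]
  have := b x
  have := b y
  gcongr

/-- The Hoffman–Wielandt bound for Stieltjes transforms: for `n × n` real symmetric
matrices `A`, `B` and `z` in the upper half-plane,
`|m_A(z) − m_B(z)|² ≤ (1/(n (Im z)⁴)) Σ_{i,j} |A_{ij} − B_{ij}|²`. -/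
theorem stieltjes_transform_hoffman_wielandt
    (n : ℕ) (A B : Matrix (Fin n) (Fin n) ℝ) (hA : A.IsSymm) (hB : B.IsSymm)
    (z : ℂ) (hz : 0 < z.im) :
    ‖stieltjesTransform A z - stieltjesTransform B z‖ ^ 2
      ≤ (1 / ((n : ℝ) * z.im ^ 4)) * ∑ i, ∑ j, |A i j - B i j| ^ 2 := by
  rcases Nat.eq_zero_or_pos n with hn | hn
  · subst hn; simp [stieltjesTransform]
  obtain ⟨U, d, hU1, hU2, rfl⟩ := aux_spec A hA
  obtain ⟨V, e, hV1, hV2, rfl⟩ := aux_spec B hB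
  rw [aux_trace U d hU1 hU2 z hz, aux_trace V e hV1 hV2 z hz]
  set W := Uᵀ * V with hW
  have hWW : W * Wᵀ = 1 := by
    rw [hW, Matrix.transpose_mul, Matrix.transpose_transpose]
    calc _ = Uᵀ * (V * Vᵀ) * U := by simp only [mul_assoc]
      _ = 1 := by rw [hV2, mul_one, hU1]
  have hWW' : Wᵀ * W = 1 := by
    rw [hW, Matrix.transpose_mul, Matrix.transpose_transpose]
    calc _ = Vᵀ * (U * Uᵀ) * V := by simp only [mul_assoc]
      _ = 1 := by rw [hU2, mul_one, hV1]
  have row : ∀ i, ∑ j, W i j ^ 2 = 1 := fun i => by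
    have := congrFun (congrFun hWW i) i
    simpa [Matrix.mul_apply, sq] using this
  have col : ∀ j, ∑ i, W i j ^ 2 = 1 := fun j => by
    have := congrFun (congrFun hWW' j) j
    simpa [Matrix.mul_apply, sq] using this
  have frob : ∑ i, ∑ j, |(U * diagonal d * Uᵀ) i j - (V * diagonal e * Vᵀ) i j| ^ 2
      = ∑ i, ∑ j, W i j ^ 2 * (d i - e j) ^ 2 := by
    have h1 : U * diagonal d * Uᵀ - V * diagonal e * Vᵀ
        = U * (diagonal d * W - W * diagonal e) * Vᵀ := by
      rw [mul_sub, sub_mul, hW]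
      congr 1
      · calc _ = U * diagonal d * Uᵀ * (V * Vᵀ) := by rw [hV2, mul_one]
          _ = _ := by simp only [mul_assoc]
      · calc _ = (U * Uᵀ) * V * diagonal e * Vᵀ := by rw [hU2, one_mul]
          _ = _ := by simp only [mul_assoc]
    have h2 := aux_frob (U * diagonal d * Uᵀ - V * diagonal e * Vᵀ)
    have h3 := aux_frob (diagonal d * W - W * diagonal e)
    set N := diagonal d * W - W * diagonal e with hN
    have h4 : (U * N * Vᵀ * (U * N * Vᵀ)ᵀ).trace = (N * Nᵀ).trace := by
      have : U * N * Vᵀ * (U * N * Vᵀ)ᵀ = U * (N * Nᵀ * Uᵀ) := by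
        simp only [Matrix.transpose_mul, Matrix.transpose_transpose]
        calc _ = U * N * (Vᵀ * V) * Nᵀ * Uᵀ := by simp only [mul_assoc]
          _ = _ := by rw [hV1, mul_one]; simp only [mul_assoc]
      rw [this, Matrix.trace_mul_comm, mul_assoc, hU1, mul_one]
    simp only [sq_abs]
    simp only [Matrix.sub_apply] at h2
    rw [h2, h1, h4, ← h3]
    refine Finset.sum_congr rfl fun i _ => Finset.sum_congr rfl fun j _ => ?_
    rw [hN, Matrix.sub_apply, Matrix.diagonal_mul, Matrix.mul_diagonal]
    ring
  rw [frob]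
  set f : ℝ → ℂ := fun x => ((x : ℂ) - z)⁻¹ with hf
  have key : ∑ i, f (d i) - ∑ j, f (e j)
      = ∑ i, ∑ j, ((W i j ^ 2 : ℝ) : ℂ) * (f (d i) - f (e j)) := by
    simp only [mul_sub, Finset.sum_sub_distrib]
    congr 1
    · refine Finset.sum_congr rfl fun i _ => ?_
      rw [← Finset.sum_mul, ← Complex.ofReal_sum, row]; simp
    · rw [Finset.sum_comm]
      refine Finset.sum_congr rfl fun i _ => ?_
      rw [← Finset.sum_mul, ← Complex.ofReal_sum, col]; simp
  have bound : ‖∑ i, f (d i) - ∑ j, f (e j)‖ ^ 2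
      ≤ n * ((∑ i, ∑ j, W i j ^ 2 * (d i - e j) ^ 2) / z.im ^ 4) := by
    rw [key]
    have s1 : ‖∑ i, ∑ j, ((W i j ^ 2 : ℝ) : ℂ) * (f (d i) - f (e j))‖
        ≤ ∑ p : Fin n × Fin n, |W p.1 p.2| * (|W p.1 p.2| * ‖f (d p.1) - f (e p.2)‖) := by
      rw [← Fintype.sum_prod_type']
      refine (norm_sum_le _ _).trans (Finset.sum_le_sum fun p _ => ?_)
      rw [norm_mul, Complex.norm_real, Real.norm_eq_abs, abs_pow, sq, mul_assoc]
    calc _ ≤ (∑ p : Fin n × Fin n, |W p.1 p.2| * (|W p.1 p.2| * ‖f (d p.1) - f (e p.2)‖)) ^ 2 := by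
          gcongr
      _ ≤ (∑ p : Fin n × Fin n, |W p.1 p.2| ^ 2) *
          ∑ p : Fin n × Fin n, (|W p.1 p.2| * ‖f (d p.1) - f (e p.2)‖) ^ 2 :=
          Finset.sum_mul_sq_le_sq_mul_sq _ _ _
      _ ≤ _ := by
          have : (∑ p : Fin n × Fin n, |W p.1 p.2| ^ 2) = n := by
            simp only [sq_abs]
            rw [Fintype.sum_prod_type]
            simp [row]
          rw [this, ← Fintype.sum_prod_type', Finset.sum_div]
          gcongr with p
          rw [mul_pow, sq_abs, mul_div_assoc]
          gcongr
          exact aux_lip _ _ z hz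
  rw [← mul_sub, norm_mul, mul_pow, norm_inv, Complex.norm_natCast]
  have hn' : (0 : ℝ) < n := by exact_mod_cast hn
  calc _ ≤ ((n : ℝ)⁻¹) ^ 2 * (n * ((∑ i, ∑ j, W i j ^ 2 * (d i - e j) ^ 2) / z.im ^ 4)) := by
        gcongr
    _ = _ := by field_simp
end

section
/- Let b>0, C>0 and c≥1. Let X be a random vector in ℝ^p with E‖X‖²=1 such that for some median m of ‖X‖ one has P(|‖X‖−m|>t)≤C·exp(−c·t^b) for all t>0. Then there exist constants C′,B>0 depending only on C and b such that for all r>0: P(|‖X‖−1|>r) ≤ C′·exp(−c·r^b/B), and consequently P(|‖X‖²−1|>r) ≤ C′·exp(−(c/B)·min(r,√r)^b). -/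
open MeasureTheory ProbabilityTheory
open scoped ENNReal


lemma aux_second_moment {Ω : Type} [MeasurableSpace Ω] (μ : Measure Ω) [IsProbabilityMeasure μ]
    (b C c : ℝ) (hb : 0 < b) (hC : 0 < C) (hc : 0 < c) (Z : Ω → ℝ) (hZ : Measurable Z)
    (hi : Integrable (fun ω => Z ω ^ 2) μ)
    (ht : ∀ t : ℝ, 0 < t → (μ {ω | t < |Z ω|}).toReal ≤ C * Real.exp (-c * t ^ b)) :
    ∫ ω, Z ω ^ 2 ∂μ ≤ 2 * C * (c ^ (-2 / b) * (1 / b) * Real.Gamma (2 / b)) := by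
  have hG : 0 < Real.Gamma (2 / b) := Real.Gamma_pos_of_pos (by positivity)
  have hI := integral_rpow_mul_exp_neg_mul_rpow (p := b) (q := 1) (b := c) hb (by norm_num) hc
  have hInt := integrableOn_rpow_mul_exp_neg_mul_rpow (p := b) (s := 1) (b := c) (by norm_num) hb hc
  norm_num at hI
  have hlc := lintegral_rpow_eq_lintegral_meas_lt_mul μ (f := fun ω => |Z ω|)
    (Filter.Eventually.of_forall fun ω => abs_nonneg _) (by fun_prop) (p := 2) (by norm_num)
  have hle : ∫⁻ t in Set.Ioi (0:ℝ), μ {a | t < |Z a|} * ENNReal.ofReal (t ^ ((2:ℝ) - 1))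
      ≤ ENNReal.ofReal (C * (c ^ (-2 / b) * (1 / b) * Real.Gamma (2 / b))) := by
    calc _ ≤ ∫⁻ t in Set.Ioi (0:ℝ), ENNReal.ofReal (C * (t ^ (1:ℝ) * Real.exp (-c * t ^ b))) := by
          apply setLIntegral_mono' measurableSet_Ioi
          intro t h
          have h0 : (0:ℝ) < t := h
          have h1 := ht t h0
          rw [← ENNReal.ofReal_toReal (measure_ne_top μ {a | t < |Z a|}),
            ← ENNReal.ofReal_mul ENNReal.toReal_nonneg]
          apply ENNReal.ofReal_le_ofReal
          norm_num
          norm_num at h1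
          nlinarith
      _ = ENNReal.ofReal (∫ t in Set.Ioi (0:ℝ), C * (t ^ (1:ℝ) * Real.exp (-c * t ^ b))) := by
          rw [ofReal_integral_eq_lintegral_ofReal (hInt.const_mul C)]
          filter_upwards [ae_restrict_mem measurableSet_Ioi] with t h
          have h0 : (0:ℝ) < t := h
          simp only [Pi.zero_apply]
          positivity
      _ ≤ _ := by
          apply ENNReal.ofReal_le_ofReal
          rw [integral_const_mul]
          apply le_of_eq
          congr 1
          norm_num
          rw [hI]
  have h2 : ENNReal.ofReal (∫ ω, Z ω ^ 2 ∂μ) ≤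
      ENNReal.ofReal (2 * C * (c ^ (-2 / b) * (1 / b) * Real.Gamma (2 / b))) := by
    rw [ofReal_integral_eq_lintegral_ofReal hi (Filter.Eventually.of_forall fun ω => sq_nonneg _)]
    have : ∀ ω, Z ω ^ 2 = |Z ω| ^ (2:ℝ) := fun ω => by norm_num
    simp only [this]
    rw [hlc, mul_assoc, ENNReal.ofReal_mul (p := 2) (by norm_num)]
    gcongr
  exact (ENNReal.ofReal_le_ofReal_iff (by positivity)).1 h2

lemma aux_median {Ω : Type} [MeasurableSpace Ω] (μ : Measure Ω) [IsProbabilityMeasure μ]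
    (b C c m : ℝ) (hb : 0 < b) (hC : 0 < C) (hc : 0 < c) (hm : 0 ≤ m) (Y : Ω → ℝ)
    (hY : Measurable Y) (h1 : ∫ ω, Y ω ^ 2 ∂μ = 1)
    (ht : ∀ t : ℝ, 0 < t → (μ {ω | t < |Y ω - m|}).toReal ≤ C * Real.exp (-c * t ^ b)) :
    (1 - m) ^ 2 ≤ 2 * C * (c ^ (-2 / b) * (1 / b) * Real.Gamma (2 / b)) := by
  have hYi : Integrable (fun ω => Y ω ^ 2) μ := by
    by_contra h
    rw [integral_undef h] at h1
    norm_num at h1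
  have hZi : Integrable (fun ω => (Y ω - m) ^ 2) μ := by
    refine Integrable.mono' (g := fun ω => 2 * Y ω ^ 2 + 2 * m ^ 2)
      ((hYi.const_mul 2).add (integrable_const _)) (by fun_prop) ?_
    filter_upwards with ω
    rw [Real.norm_of_nonneg (sq_nonneg _)]
    nlinarith [sq_nonneg (Y ω + m)]
  refine le_trans ?_ (aux_second_moment μ b C c hb hC hc (fun ω => Y ω - m) (by fun_prop) hZi ht)
  have h3 : ∫ ω, ((1 - m) * Y ω ^ 2 + (m ^ 2 - m)) ∂μ = (1 - m) ^ 2 := by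
    rw [integral_add (hYi.const_mul _) (integrable_const _), integral_const_mul, h1]
    simp
    ring
  rw [← h3]
  apply integral_mono ((hYi.const_mul _).add (integrable_const _)) hZi
  intro ω
  simp only [Pi.add_apply]
  nlinarith [mul_nonneg hm (sq_nonneg (Y ω - 1))]

lemma aux_first {Ω : Type} [MeasurableSpace Ω] (μ : Measure Ω) [IsProbabilityMeasure μ]
    (b C c m : ℝ) (hb : 0 < b) (hC : 0 < C) (hc : 0 < c) (hm : 0 ≤ m) (Y : Ω → ℝ)
    (hY : Measurable Y) (h1 : ∫ ω, Y ω ^ 2 ∂μ = 1)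
    (ht : ∀ t : ℝ, 0 < t → (μ {ω | t < |Y ω - m|}).toReal ≤ C * Real.exp (-c * t ^ b))
    (r : ℝ) (hr : 0 < r) :
    (μ {ω | r < |Y ω - 1|}).toReal ≤
      (C + Real.exp ((2 * C * ((1 / b) * Real.Gamma (2 / b))) ^ (b / 2))) *
        Real.exp (-c * (r / 2) ^ b) := by
  have hG : 0 < Real.Gamma (2 / b) := Real.Gamma_pos_of_pos (by positivity)
  set K := 2 * C * ((1 / b) * Real.Gamma (2 / b)) with hK
  have hK0 : 0 < K := by positivity
  have hmed : (1 - m) ^ 2 ≤ K * c ^ (-2 / b) := by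
    refine (aux_median μ b C c m hb hC hc hm Y hY h1 ht).trans (le_of_eq ?_)
    rw [hK]; ring
  by_cases hcase : |1 - m| ≤ r / 2
  · calc (μ {ω | r < |Y ω - 1|}).toReal ≤ (μ {ω | r / 2 < |Y ω - m|}).toReal := by
          apply ENNReal.toReal_mono (measure_ne_top _ _)
          apply measure_mono
          intro ω h
          simp only [Set.mem_setOf_eq] at h ⊢
          have := abs_sub_le (Y ω) m 1
          rw [abs_sub_comm m 1] at this
          linarith
      _ ≤ C * Real.exp (-c * (r / 2) ^ b) := ht _ (by positivity)
      _ ≤ _ := by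
          gcongr
          have := Real.exp_pos (K ^ (b / 2))
          linarith
  · push Not at hcase
    have hsq : (r / 2) ^ 2 ≤ K * c ^ (-2 / b) := by
      refine le_trans ?_ hmed
      rw [← sq_abs (1 - m)]
      gcongr
    have hpow : c * (r / 2) ^ b ≤ K ^ (b / 2) := by
      have := Real.rpow_le_rpow (by positivity) hsq (show 0 ≤ b / 2 by positivity)
      rw [Real.mul_rpow hK0.le (by positivity), ← Real.rpow_mul hc.le,
        ← Real.rpow_natCast, ← Real.rpow_mul (by positivity)] at this
      have e1 : ((2:ℕ):ℝ) * (b / 2) = b := by push_cast; ring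
      have e2 : -2 / b * (b / 2) = -1 := by field_simp
      rw [e1, e2, Real.rpow_neg_one] at this
      calc c * (r / 2) ^ b ≤ c * (K ^ (b / 2) * c⁻¹) := by gcongr
        _ = _ := by field_simp
    calc (μ {ω | r < |Y ω - 1|}).toReal ≤ 1 := by
          exact measureReal_le_one
      _ ≤ Real.exp (K ^ (b / 2)) * Real.exp (-c * (r / 2) ^ b) := by
          rw [← Real.exp_add]
          apply Real.one_le_exp
          linarith
      _ ≤ _ := by
          gcongr
          linarith

/-- From concentration of `‖X‖` around a median to concentration of `‖X‖` and `‖X‖²`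
around `1`: if `E‖X‖² = 1` and `P(|‖X‖ − m| > t) ≤ C exp(−c t^b)` for a median `m` of
`‖X‖` and all `t > 0` (with `c ≥ 1`), then there are constants `C′, B > 0` depending only
on `C` and `b` such that for all `r > 0`, `P(|‖X‖ − 1| > r) ≤ C′ exp(−c r^b / B)` and
`P(|‖X‖² − 1| > r) ≤ C′ exp(−(c/B) min(r, √r)^b)`. -/
theorem norm_concentration_around_one (b C : ℝ) (hb : 0 < b) (hC : 0 < C) :
    ∃ C' B : ℝ, 0 < C' ∧ 0 < B ∧
      ∀ (Ω : Type) [MeasureSpace Ω] [IsProbabilityMeasure (ℙ : Measure Ω)]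
        (p : ℕ) (X : Ω → EuclideanSpace ℝ (Fin p)),
        Measurable X →
        ∀ c : ℝ, 1 ≤ c →
        -- normalization E‖X‖² = 1
        (∫ ω, ‖X ω‖ ^ 2 ∂(ℙ : Measure Ω)) = 1 →
        -- m is a median of ‖X‖
        ∀ m : ℝ,
          (1 / 2 : ℝ≥0∞) ≤ ℙ {ω | m ≤ ‖X ω‖} →
          (1 / 2 : ℝ≥0∞) ≤ ℙ {ω | ‖X ω‖ ≤ m} →
          -- tail bound around the median
          (∀ t : ℝ, 0 < t →
            (ℙ {ω | t < |‖X ω‖ - m|}).toReal ≤ C * Real.exp (-c * t ^ b)) →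
          ∀ r : ℝ, 0 < r →
            (ℙ {ω | r < |‖X ω‖ - 1|}).toReal ≤ C' * Real.exp (-c * r ^ b / B) ∧
            (ℙ {ω | r < |‖X ω‖ ^ 2 - 1|}).toReal
              ≤ C' * Real.exp (-(c / B) * min r (Real.sqrt r) ^ b) := by
  refine ⟨C + Real.exp ((2 * C * ((1 / b) * Real.Gamma (2 / b))) ^ (b / 2)), 6 ^ b,
    by positivity, by positivity, ?_⟩
  intro Ω _ _ p X hX c hc h1 m _ hm2 ht r hr
  have hc0 : 0 < c := by linarith
  have hm : 0 ≤ m := by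
    by_contra h
    push Not at h
    have : {ω | ‖X ω‖ ≤ m} = ∅ := by
      ext ω
      simp only [Set.mem_setOf_eq, Set.mem_empty_iff_false, iff_false, not_le]
      exact h.trans_le (norm_nonneg _)
    rw [this] at hm2
    simp at hm2
  have key := aux_first (ℙ : Measure Ω) b C c m hb hC hc0 hm (fun ω => ‖X ω‖) hX.norm h1 ht
  constructor
  · refine (key r hr).trans ?_
    gcongr
    rw [neg_mul, neg_mul, neg_div, neg_le_neg_iff, mul_div_assoc, ← Real.div_rpow hr.le (by norm_num)]
    gcongr
    norm_num
  · have hs : 0 < Real.sqrt r := Real.sqrt_pos.2 hr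
    set s := min r (Real.sqrt r) with hsd
    have hs0 : 0 < s := lt_min hr hs
    have e : -(c / 6 ^ b) * s ^ b = -c * (s / 3 / 2) ^ b := by
      rw [div_div, Real.div_rpow hs0.le (by norm_num)]
      norm_num
      ring
    rw [e]
    refine le_trans ?_ (key (s / 3) (by positivity))
    apply ENNReal.toReal_mono (measure_ne_top _ _)
    apply measure_mono
    intro ω h
    simp only [Set.mem_setOf_eq] at h ⊢
    by_contra hn
    push Not at hn
    have hsr : s ≤ r := min_le_left _ _
    have hss : s ^ 2 ≤ r := by
      calc s ^ 2 ≤ Real.sqrt r ^ 2 := by gcongr; exact min_le_right _ _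
        _ = r := Real.sq_sqrt hr.le
    have h5 : |‖X ω‖ ^ 2 - 1| = |‖X ω‖ - 1| * (‖X ω‖ + 1) := by
      rw [← abs_of_nonneg (show 0 ≤ ‖X ω‖ + 1 by positivity), ← abs_mul]
      ring_nf
    have h6 : ‖X ω‖ + 1 ≤ s / 3 + 2 := by linarith [(abs_le.1 hn).2]
    have h7 : |‖X ω‖ - 1| * (‖X ω‖ + 1) ≤ s / 3 * (s / 3 + 2) := by gcongr
    nlinarith
end

section
/- Fix k≥0. There exist constants δ_0>0 and C, both depending only on k, with the following property. Let μ be a probability measure on ℝ with finite moments up to order 2k such that |∫x^j dμ(x) − ∫x^j dγ(x)| ≤ δ for every 0≤j≤2k, where γ is the standard Gaussian measure on ℝ and 0<δ≤δ_0. Suppose q is a polynomial of degree k with positive leading coefficient satisfying ∫q(x)² dμ(x)=1 and ∫x^j q(x) dμ(x)=0 for all 0≤j<k (i.e., q is the k-th orthonormal polynomial of μ). Then |q(x) − ĥ_k(x)| ≤ C·δ·(1+|x|^k) for all x∈ℝ, where ĥ_k = He_k/√(k!) is the k-th orthonormal Hermite polynomial (He_k the probabilists' Hermite polynomial). -/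
open MeasureTheory ProbabilityTheory Polynomial

/-- formal moment functional -/
noncomputable def momF (μ : Measure ℝ) : ℝ[X] →ₗ[ℝ] ℝ :=
  Polynomial.lsum (fun n => (∫ x, x ^ n ∂μ) • (LinearMap.id : ℝ →ₗ[ℝ] ℝ))

lemma momF_eq_sum (μ : Measure ℝ) (p : ℝ[X]) (N : ℕ) (hp : p.natDegree ≤ N) :
    momF μ p = ∑ i ∈ Finset.range (N + 1), p.coeff i * ∫ x, x ^ i ∂μ := by
  have h : momF μ p = p.sum (fun n c => c * ∫ x, x ^ n ∂μ) := by
    simp [momF, Polynomial.lsum_apply, mul_comm]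
  rw [h, Polynomial.sum_over_range' p (by simp) (N + 1) (by omega)]

lemma poly_integrable (μ : Measure ℝ) (p : ℝ[X]) (N : ℕ) (hp : p.natDegree ≤ N)
    (hμ : ∀ j ≤ N, Integrable (fun x => x ^ j) μ) : Integrable (fun x => p.eval x) μ := by
  have h : (fun x => p.eval x) = fun x => ∑ i ∈ Finset.range (N + 1), p.coeff i * x ^ i := by
    ext x
    rw [Polynomial.eval_eq_sum_range' (n := N + 1) (by omega)]
  rw [h]
  refine integrable_finsetSum _ fun i hi => ?_
  exact (hμ i (by simp at hi; omega)).const_mul _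

lemma integral_poly (μ : Measure ℝ) (p : ℝ[X]) (N : ℕ) (hp : p.natDegree ≤ N)
    (hμ : ∀ j ≤ N, Integrable (fun x => x ^ j) μ) : ∫ x, p.eval x ∂μ = momF μ p := by
  rw [momF_eq_sum μ p N hp]
  have h : (fun x => p.eval x) = fun x => ∑ i ∈ Finset.range (N + 1), p.coeff i * x ^ i := by
    ext x
    rw [Polynomial.eval_eq_sum_range' (n := N + 1) (by omega)]
  rw [h, integral_finsetSum]
  · simp_rw [integral_const_mul]
  · intro i hi
    exact (hμ i (by simp at hi; omega)).const_mul _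

lemma gauss_pow_integrable (j : ℕ) : Integrable (fun x : ℝ => x ^ j) (gaussianReal 0 1) := by
  have h := (memLp_id_gaussianReal' (μ := 0) (v := 1) (j : ENNReal) (by simp)).integrable_norm_pow'
  refine h.mono' (by fun_prop) (Filter.Eventually.of_forall fun x => ?_)
  simp

lemma gauss_poly_integrable (p : ℝ[X]) :
    Integrable (fun x => p.eval x) (gaussianReal 0 1) :=
  poly_integrable _ p _ le_rfl fun j _ => gauss_pow_integrable j

lemma gauss_poly_integrable' (p : ℝ[X]) :
    Integrable (fun x => p.eval x * gaussianPDFReal 0 1 x) := by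
  have h := gauss_poly_integrable p
  rw [gaussianReal_of_var_ne_zero _ one_ne_zero,
    integrable_withDensity_iff_integrable_smul' (measurable_gaussianPDF _ _)
      (ae_of_all _ fun _ ↦ gaussianPDF_lt_top)] at h
  simpa [mul_comm] using h

lemma stein_integral (p : ℝ[X]) :
    ∫ x, (X * p).eval x ∂(gaussianReal 0 1) = ∫ x, (derivative p).eval x ∂(gaussianReal 0 1) := by
  rw [integral_gaussianReal_eq_integral_smul one_ne_zero,
    integral_gaussianReal_eq_integral_smul one_ne_zero]
  have hd : ∀ x, HasDerivAt (gaussianPDFReal 0 1) (-x * gaussianPDFReal 0 1 x) x := by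
    intro x
    rw [gaussianPDFReal_def]
    have h1 : HasDerivAt (fun x : ℝ => -(x - 0) ^ 2 / (2 * ((1 : NNReal) : ℝ))) (-x) x := by
      have := ((((hasDerivAt_id' x).sub_const 0).pow 2).neg).div_const (2 * ((1 : NNReal) : ℝ))
      refine this.congr_deriv ?_
      simp only [NNReal.coe_one]
      norm_num
      ring
    refine ((h1.exp).const_mul ((√(2 * Real.pi * ((1 : NNReal) : ℝ)))⁻¹)).congr_deriv ?_
    ring
  have e := integral_mul_deriv_eq_deriv_mul_of_integrable (u := fun x => p.eval x)
    (u' := fun x => (derivative p).eval x) (v := gaussianPDFReal 0 1)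
    (v' := fun x => -x * gaussianPDFReal 0 1 x) (fun x _ => p.hasDerivAt x) (fun x _ => hd x)
    (by
      have := (gauss_poly_integrable' (X * p)).neg
      refine this.congr (Filter.Eventually.of_forall fun x => ?_)
      simp; ring)
    (gauss_poly_integrable' _) (gauss_poly_integrable' _)
  have e1 : ∫ x, gaussianPDFReal 0 1 x • (X * p).eval x
      = - ∫ x, p.eval x * (-x * gaussianPDFReal 0 1 x) := by
    rw [← integral_neg]
    congr 1; ext x; simp; ring
  rw [e1, e, neg_neg]
  congr 1; ext x; simp; ring

lemma gauss_momF (p : ℝ[X]) : ∫ x, p.eval x ∂(gaussianReal 0 1) = momF (gaussianReal 0 1) p :=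
  integral_poly _ p _ le_rfl fun j _ => gauss_pow_integrable j

lemma stein (p : ℝ[X]) :
    momF (gaussianReal 0 1) (X * p) = momF (gaussianReal 0 1) (derivative p) := by
  rw [← gauss_momF, ← gauss_momF, stein_integral]

/-- real Hermite polynomial -/
noncomputable def hR (k : ℕ) : ℝ[X] := (Polynomial.hermite k).map (Int.castRingHom ℝ)

lemma hR_succ (n : ℕ) : hR (n + 1) = X * hR n - derivative (hR n) := by
  simp [hR, Polynomial.hermite_succ, Polynomial.derivative_map]

lemma hR_natDegree (n : ℕ) : (hR n).natDegree = n := by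
  rw [hR, (Polynomial.hermite_monic n).natDegree_map, Polynomial.natDegree_hermite]

lemma hR_coeff (n : ℕ) : (hR n).coeff n = 1 := by
  simp [hR]

lemma gauss_hR_mul (n : ℕ) (p : ℝ[X]) :
    momF (gaussianReal 0 1) (hR n * p) = momF (gaussianReal 0 1) (derivative^[n] p) := by
  induction n generalizing p with
  | zero => simp [hR]
  | succ n ih =>
    rw [Function.iterate_succ_apply, ← ih, hR_succ]
    have : (X * hR n - derivative (hR n)) * p = X * (hR n * p) - derivative (hR n) * p := by ring
    rw [this, map_sub, stein, derivative_mul, map_add]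
    ring

lemma gauss_hR_lt {m n : ℕ} (h : m < n) : momF (gaussianReal 0 1) (hR n * hR m) = 0 := by
  rw [gauss_hR_mul, iterate_derivative_eq_zero (by rw [hR_natDegree]; exact h), map_zero]

lemma gauss_hR_self (n : ℕ) : momF (gaussianReal 0 1) (hR n * hR n) = n.factorial := by
  rw [gauss_hR_mul]
  have h : derivative^[n] (hR n) = Polynomial.C (n.factorial : ℝ) := by
    ext j
    rw [coeff_iterate_derivative]
    rcases j with _ | j
    · simp [hR_coeff, Nat.descFactorial_self]
    · rw [coeff_eq_zero_of_natDegree_lt (by rw [hR_natDegree]; omega), Polynomial.coeff_C]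
      simp
  rw [h, momF_eq_sum _ _ 0 (by simp)]
  simp

/-- normalised -/
noncomputable def gH (k : ℕ) : ℝ[X] := (1 / Real.sqrt (Nat.factorial k)) • hR k

lemma sqrt_fact_pos (k : ℕ) : 0 < Real.sqrt (Nat.factorial k) :=
  Real.sqrt_pos.2 (by exact_mod_cast Nat.factorial_pos k)

lemma gH_natDegree (n : ℕ) : (gH n).natDegree ≤ n := by
  exact (natDegree_smul_le _ _).trans (hR_natDegree n).le

lemma gH_coeff (n : ℕ) : (gH n).coeff n = 1 / Real.sqrt (Nat.factorial n) := by
  simp [gH, hR_coeff]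

lemma gH_orth (m n : ℕ) : momF (gaussianReal 0 1) (gH m * gH n) = if m = n then 1 else 0 := by
  simp only [gH, smul_mul_smul_comm, map_smul, smul_eq_mul]
  split_ifs with h
  · subst h
    rw [gauss_hR_self]
    have := sqrt_fact_pos m
    have h2 := Real.mul_self_sqrt (Nat.cast_nonneg (α := ℝ) m.factorial)
    field_simp
    nlinarith
  · rcases lt_or_gt_of_ne h with h | h
    · rw [mul_comm (hR m), gauss_hR_lt h, mul_zero]
    · rw [gauss_hR_lt h, mul_zero]

lemma expand (n : ℕ) : ∀ q : ℝ[X], q.natDegree ≤ n → ∃ a : ℕ → ℝ,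
    q = ∑ m ∈ Finset.range (n + 1), a m • gH m := by
  induction n with
  | zero =>
    intro q hq
    refine ⟨fun _ => q.coeff 0, ?_⟩
    rw [eq_C_of_natDegree_le_zero hq]
    simp [gH, hR, Polynomial.smul_eq_C_mul]
  | succ n ih =>
    intro q hq
    set c := q.coeff (n + 1) * Real.sqrt (Nat.factorial (n + 1)) with hc
    have hlt : (q - c • gH (n + 1)).natDegree ≤ n := by
      rw [natDegree_le_iff_coeff_eq_zero]
      intro N hN
      rcases Nat.lt_or_ge (n + 1) N with h | h
      · rw [coeff_sub, coeff_smul, coeff_eq_zero_of_natDegree_lt (by omega),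
          coeff_eq_zero_of_natDegree_lt ((gH_natDegree _).trans_lt h)]
        simp
      · obtain rfl : N = n + 1 := by omega
        have := sqrt_fact_pos (n + 1)
        rw [coeff_sub, coeff_smul, gH_coeff, hc, smul_eq_mul]
        field_simp
        ring
    obtain ⟨a, ha⟩ := ih _ hlt
    refine ⟨fun m => if m = n + 1 then c else a m, ?_⟩
    rw [Finset.sum_range_succ]
    have : ∑ m ∈ Finset.range (n + 1), (if m = n + 1 then c else a m) • gH m
        = ∑ m ∈ Finset.range (n + 1), a m • gH m := by
      refine Finset.sum_congr rfl fun m hm => ?_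
      rw [if_neg (by simp at hm; omega)]
    rw [this, ← ha]
    simp

lemma expand_coeff (k : ℕ) (a : ℕ → ℝ) :
    (∑ m ∈ Finset.range (k + 1), a m • gH m).coeff k = a k / Real.sqrt (Nat.factorial k) := by
  rw [Finset.sum_range_succ, coeff_add, finsetSum_coeff, Finset.sum_eq_zero, coeff_smul, gH_coeff]
  · simp [div_eq_mul_inv]
  · intro m hm
    rw [coeff_smul, coeff_eq_zero_of_natDegree_lt
      ((gH_natDegree _).trans_lt (by simpa using hm)), smul_zero]

/-- coefficient norm -/
noncomputable def cN (N : ℕ) (p : ℝ[X]) : ℝ := ∑ i ∈ Finset.range (N + 1), |p.coeff i|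

lemma cN_nonneg (N : ℕ) (p : ℝ[X]) : 0 ≤ cN N p := Finset.sum_nonneg fun _ _ => abs_nonneg _

lemma eval_le (k : ℕ) (p : ℝ[X]) (hp : p.natDegree ≤ k) (x : ℝ) :
    |p.eval x| ≤ cN k p * (1 + |x| ^ k) := by
  rw [Polynomial.eval_eq_sum_range' (n := k + 1) (by omega), cN, Finset.sum_mul]
  refine (Finset.abs_sum_le_sum_abs _ _).trans (Finset.sum_le_sum fun i hi => ?_)
  rw [abs_mul, abs_pow]
  refine mul_le_mul_of_nonneg_left ?_ (abs_nonneg _)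
  rcases le_total |x| 1 with h | h
  · have := pow_le_one₀ (n := i) (abs_nonneg x) h
    have : 0 ≤ |x| ^ k := by positivity
    linarith
  · have := pow_le_pow_right₀ h (show i ≤ k by simp at hi; omega)
    linarith

lemma mom_diff (μ ν : Measure ℝ) (N : ℕ) (δ : ℝ) (p : ℝ[X]) (hp : p.natDegree ≤ N)
    (h : ∀ j ≤ N, |(∫ x, x ^ j ∂μ) - ∫ x, x ^ j ∂ν| ≤ δ) :
    |momF μ p - momF ν p| ≤ cN N p * δ := by
  rw [momF_eq_sum μ p N hp, momF_eq_sum ν p N hp, ← Finset.sum_sub_distrib, cN, Finset.sum_mul]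
  refine (Finset.abs_sum_le_sum_abs _ _).trans (Finset.sum_le_sum fun i hi => ?_)
  rw [← mul_sub, abs_mul]
  exact mul_le_mul_of_nonneg_left (h i (by simp at hi; omega)) (abs_nonneg _)

/-- the linear algebra core -/
lemma core (k : ℕ) (a b : ℕ → ℝ) (ε : ℝ) (hε : 0 ≤ ε) (hk : ε * (k + 1) ≤ 1 / 4)
    (hak : 0 < a k)
    (hb : ∀ m ≤ k, |b m - a m| ≤ ε * ∑ j ∈ Finset.range (k + 1), |a j|)
    (h0 : ∀ m < k, b m = 0) (h1 : ∑ m ∈ Finset.range (k + 1), a m * b m = 1) :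
    ∀ m ≤ k, |a m - if m = k then 1 else 0| ≤ 4 * ε := by
  set S := ∑ j ∈ Finset.range (k + 1), |a j| with hS
  have hm : ∀ m < k, |a m| ≤ ε * S := by
    intro m hm
    have := hb m hm.le
    rwa [h0 m hm, zero_sub, abs_neg] at this
  have hS1 : S ≤ k * (ε * S) + a k := by
    conv_lhs => rw [hS]
    rw [Finset.sum_range_succ, abs_of_pos hak]
    have := Finset.sum_le_card_nsmul (Finset.range k) (fun j => |a j|) (ε * S)
      (fun m h => hm m (by simpa using h))
    simp at this
    linarith
  have hS0 : 0 ≤ S := Finset.sum_nonneg fun _ _ => abs_nonneg _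
  have hε4 : ε ≤ 1 / 4 := by nlinarith [Nat.cast_nonneg (α := ℝ) k]
  have hS2 : S ≤ 2 * a k := by
    nlinarith
  have hk1 : a k * b k = 1 := by
    rw [Finset.sum_range_succ, Finset.sum_eq_zero] at h1
    · linarith
    · intro m h
      rw [h0 m (by simpa using h), mul_zero]
  have hbk := abs_le.1 (hb k le_rfl)
  have hεS : ε * S ≤ 2 * ε * a k := by nlinarith
  have l1 : a k * (b k - a k) ≤ a k * (2 * ε * a k) :=
    mul_le_mul_of_nonneg_left (by linarith) hak.le
  have l2 : a k * (-(2 * ε * a k)) ≤ a k * (b k - a k) :=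
    mul_le_mul_of_nonneg_left (by linarith) hak.le
  have hsq : a k ^ 2 ≤ 2 := by nlinarith [mul_nonneg (sub_nonneg.2 hε4) (sq_nonneg (a k))]
  have hak2 : a k ≤ 2 := by nlinarith
  have h4 : ε * a k ^ 2 ≤ ε * 2 := mul_le_mul_of_nonneg_left hsq hε
  have u1 : a k ^ 2 - 1 ≤ 4 * ε := by nlinarith
  have u2 : -(4 * ε) ≤ a k ^ 2 - 1 := by nlinarith
  intro m hmk
  split_ifs with h
  · subst h
    rw [abs_le]
    constructor
    · rcases le_total 1 (a m) with h | h
      · linarith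
      · nlinarith
    · rcases le_total 1 (a m) with h | h
      · nlinarith
      · linarith
  · rw [sub_zero]
    refine (hm m (by omega)).trans ?_
    nlinarith

lemma exists_M (k : ℕ) : ∃ M : ℝ, 0 < M ∧ ∀ i ≤ k, ∀ j ≤ k, cN (2 * k) (gH i * gH j) ≤ M := by
  refine ⟨1 + ∑ i ∈ Finset.range (k + 1), ∑ j ∈ Finset.range (k + 1),
    cN (2 * k) (gH i * gH j), ?_, ?_⟩
  · have : 0 ≤ ∑ i ∈ Finset.range (k + 1), ∑ j ∈ Finset.range (k + 1),
      cN (2 * k) (gH i * gH j) :=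
      Finset.sum_nonneg fun _ _ => Finset.sum_nonneg fun _ _ => cN_nonneg _ _
    linarith
  · intro i hi j hj
    have h1 : cN (2 * k) (gH i * gH j) ≤ ∑ j ∈ Finset.range (k + 1), cN (2 * k) (gH i * gH j) :=
      Finset.single_le_sum (f := fun j => cN (2 * k) (gH i * gH j))
        (fun _ _ => cN_nonneg _ _) (Finset.mem_range.2 (Nat.lt_succ_of_le hj))
    have h2 : ∑ j ∈ Finset.range (k + 1), cN (2 * k) (gH i * gH j) ≤
        ∑ i ∈ Finset.range (k + 1), ∑ j ∈ Finset.range (k + 1), cN (2 * k) (gH i * gH j) :=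
      Finset.single_le_sum (f := fun i => ∑ j ∈ Finset.range (k + 1),
        cN (2 * k) (gH i * gH j)) (fun _ _ => Finset.sum_nonneg fun _ _ => cN_nonneg _ _)
        (Finset.mem_range.2 (Nat.lt_succ_of_le hi))
    linarith

theorem orthonormal_polynomial_hermite_comparison (k : ℕ) :
    ∃ δ₀ C : ℝ, 0 < δ₀ ∧ 0 < C ∧
      ∀ (μ : Measure ℝ), IsProbabilityMeasure μ →
        ∀ δ : ℝ, 0 < δ → δ ≤ δ₀ →
        -- finite moments up to order 2k
        (∀ j ≤ 2 * k, Integrable (fun x => x ^ j) μ) →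
        -- the moments are within δ of the standard Gaussian moments
        (∀ j ≤ 2 * k,
          |(∫ x, x ^ j ∂μ) - ∫ x, x ^ j ∂(gaussianReal 0 1)| ≤ δ) →
        -- q is the k-th orthonormal polynomial of μ
        ∀ q : Polynomial ℝ,
          q.degree = (k : ℕ) →
          0 < q.leadingCoeff →
          (∫ x, (q.eval x) ^ 2 ∂μ) = 1 →
          (∀ j < k, ∫ x, x ^ j * q.eval x ∂μ = 0) →
          ∀ x : ℝ,
            |q.eval x - ((Polynomial.hermite k).map (Int.castRingHom ℝ)).eval x
                / Real.sqrt (Nat.factorial k)|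
              ≤ C * δ * (1 + |x| ^ k) := by
  obtain ⟨M, hM0, hMle⟩ := exists_M k
  set B : ℝ := ∑ m ∈ Finset.range (k + 1), cN k (gH m) with hB
  have hB0 : 0 ≤ B := Finset.sum_nonneg fun _ _ => cN_nonneg _ _
  refine ⟨1 / (4 * M * (k + 1)), 4 * M * B + 1, by positivity, by positivity, ?_⟩
  intro μ _ δ hδ hδ0 hint hmom q hdeg hlead hq1 hq0 x
  have hnd : q.natDegree = k := natDegree_eq_of_degree_eq_some hdeg
  obtain ⟨a, ha⟩ := expand k q hnd.le
  have hak : 0 < a k := by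
    rw [leadingCoeff, hnd, ha, expand_coeff] at hlead
    exact (div_pos_iff_of_pos_right (sqrt_fact_pos k)).1 hlead
  have hres := core k a (fun m => momF μ (q * gH m)) (M * δ) (by positivity)
    (by
      rw [le_div_iff₀ (by positivity)] at hδ0
      linarith) hak
    (by
      intro m hm
      have hD : momF μ (q * gH m) - a m = ∑ j ∈ Finset.range (k + 1),
          a j * (momF μ (gH j * gH m) - momF (gaussianReal 0 1) (gH j * gH m)) := by
        have e1 : momF μ (q * gH m) = ∑ j ∈ Finset.range (k + 1), a j * momF μ (gH j * gH m) := by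
          rw [ha, Finset.sum_mul, map_sum]
          simp [smul_mul_assoc]
        have e2 : a m = ∑ j ∈ Finset.range (k + 1),
            a j * momF (gaussianReal 0 1) (gH j * gH m) := by
          simp only [gH_orth, mul_ite, mul_one, mul_zero]
          rw [Finset.sum_ite_eq', if_pos (by simp; omega)]
        rw [e1]
        conv_lhs => rw [e2]
        rw [← Finset.sum_sub_distrib]
        simp only [mul_sub]
      rw [hD, Finset.mul_sum]
      refine (Finset.abs_sum_le_sum_abs _ _).trans (Finset.sum_le_sum fun j hj => ?_)
      have hj' : j ≤ k := by simp at hj; omega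
      rw [abs_mul, mul_comm]
      refine mul_le_mul_of_nonneg_right ?_ (abs_nonneg _)
      refine (mom_diff _ _ (2 * k) δ _ ?_ hmom).trans
        (mul_le_mul_of_nonneg_right (hMle j hj' m hm) hδ.le)
      refine natDegree_mul_le.trans ?_
      have := gH_natDegree j
      have := gH_natDegree m
      omega)
    (by
      intro m hm
      have hx : ∀ j < k, momF μ (q * X ^ j) = 0 := by
        intro j hj
        rw [← hq0 j hj, ← integral_poly μ _ (2 * k) _ hint]
        · simp [mul_comm]
        · refine natDegree_mul_le.trans ?_
          rw [natDegree_X_pow]; omega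
      have hg : gH m = ∑ i ∈ Finset.range (m + 1), (gH m).coeff i • (X : ℝ[X]) ^ i := by
        conv_lhs => rw [(gH m).as_sum_range' (m + 1) (Nat.lt_succ_of_le (gH_natDegree m))]
        simp [← Polynomial.C_mul_X_pow_eq_monomial, Polynomial.smul_eq_C_mul]
      rw [hg, Finset.mul_sum, map_sum]
      refine Finset.sum_eq_zero fun i hi => ?_
      rw [mul_smul_comm, map_smul, hx i (by simp at hi; omega), smul_zero])
    (by
      have e : momF μ (q * q) = 1 := by
        rw [← hq1, ← integral_poly μ _ (2 * k) _ hint]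
        · simp [sq]
        · refine natDegree_mul_le.trans ?_
          omega
      rw [← e]
      conv_rhs => rw [show q * q = q * ∑ m ∈ Finset.range (k + 1), a m • gH m by rw [← ha]]
      rw [Finset.mul_sum, map_sum]
      simp [mul_smul_comm])
  have hfin : q.eval x - ((Polynomial.hermite k).map (Int.castRingHom ℝ)).eval x
      / Real.sqrt (Nat.factorial k)
      = ∑ m ∈ Finset.range (k + 1), (a m - if m = k then 1 else 0) * (gH m).eval x := by
    simp only [sub_mul, Finset.sum_sub_distrib, ite_mul, one_mul, zero_mul]
    rw [Finset.sum_ite_eq', if_pos (by simp)]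
    congr 1
    · conv_lhs => rw [ha]
      simp [eval_finsetSum]
    · simp [gH, hR, div_eq_mul_inv, mul_comm]
  rw [hfin]
  calc _ ≤ ∑ m ∈ Finset.range (k + 1), 4 * (M * δ) * (cN k (gH m) * (1 + |x| ^ k)) := by
        refine (Finset.abs_sum_le_sum_abs _ _).trans (Finset.sum_le_sum fun m hm => ?_)
        have hm' : m ≤ k := by simp at hm; omega
        rw [abs_mul]
        exact mul_le_mul (hres m hm') (eval_le k _ ((gH_natDegree m).trans hm') x)
          (abs_nonneg _) (by positivity)
    _ = 4 * M * B * δ * (1 + |x| ^ k) := by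
        rw [← Finset.mul_sum, ← Finset.sum_mul, ← hB]; ring
    _ ≤ _ := by
        have : 0 ≤ δ * (1 + |x| ^ k) := by positivity
        nlinarith
end
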